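/- In the arc-and-ball setting below, assuming additionally that the total derivative Df(x) is surjective at every x ∈ E_{[0,1]}, for every i ∈ ℕ and every x_*^R ∈ E^R_{(0,1]}, the inclusion (E_{(0,1]}, E^R_{(0,1]}) ⊆ (E^-_{[0,1]}, E^R_{[0,1]}) induces a bijection (an isomorphism of relative homotopy groups) π_i(E_{(0,1]}, E^R_{(0,1]}, x_*^R) ≅ π_i(E^-_{[0,1]}, E^R_{[0,1]}, x_*^R). -/

import Mathlib

open scoped unitInterval
open Set Filter Topology Metric

noncomputable section

/-! ### Cubes and relative homotopy groups -/

/-- The `n`-dimensional unit cube `I^n = [0,1]^n`. -/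
abbrev Cube (n : ℕ) := Fin n → I

/-- The subset `J_{i+1} = ∂ I^{i+1} ∖ (Int I^i × {0})` of the cube `I^{i+1}`;
the last coordinate plays the role of the distinguished (base-face) coordinate. -/
def JSet (i : ℕ) : Set (Cube (i + 1)) :=
  {p | (∃ j, p j = 0 ∨ p j = 1) ∧
    ¬(p (Fin.last i) = 0 ∧ ∀ j : Fin i, p j.castSucc ≠ 0 ∧ p j.castSucc ≠ 1)}

/-- A continuous map `h : I^{i+1} → A` with `h(I^i × {0}) ⊆ B` and `h(J_{i+1}) = {x0}`,
i.e. the maps representing elements of the relative homotopy group `π_{i+1}(A, B, x0)`. -/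
structure IsRelMap {X : Type*} [TopologicalSpace X] (i : ℕ) (A B : Set X) (x0 : X)
    (h : Cube (i + 1) → X) : Prop where
  continuous : Continuous h
  mem_total : ∀ p, h p ∈ A
  mem_base : ∀ p : Cube (i + 1), p (Fin.last i) = 0 → h p ∈ B
  eq_base_pt : ∀ p ∈ JSet i, h p = x0

/-- Homotopy of two representing maps through maps of the same form. -/
def RelHomotopic {X : Type*} [TopologicalSpace X] (i : ℕ) (A B : Set X) (x0 : X)
    (h₀ h₁ : Cube (i + 1) → X) : Prop :=
  ∃ H : Cube (i + 1) × I → X, Continuous H ∧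
    (∀ τ : I, IsRelMap i A B x0 fun p => H (p, τ)) ∧
    (∀ p, H (p, 0) = h₀ p) ∧ ∀ p, H (p, 1) = h₁ p

/-- `π_{i+1}(A, B, x0) = 1`: every representing map is homotopic, through maps of the same
form, to a map with image contained in `B`. -/
def RelPiTrivial {X : Type*} [TopologicalSpace X] (i : ℕ) (A B : Set X) (x0 : X) : Prop :=
  ∀ h : Cube (i + 1) → X, IsRelMap i A B x0 h →
    ∃ h' : Cube (i + 1) → X, IsRelMap i A B x0 h' ∧ (∀ p, h' p ∈ B) ∧
      RelHomotopic i A B x0 h h'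

/-- The set of homotopy classes forming the relative homotopy group `π_{i+1}(A, B, x0)`. -/
def RelPi {X : Type*} [TopologicalSpace X] (i : ℕ) (A B : Set X) (x0 : X) : Type _ :=
  Quot fun h₁ h₂ : {h : Cube (i + 1) → X // IsRelMap i A B x0 h} =>
    RelHomotopic i A B x0 h₁.1 h₂.1

theorem IsRelMap.mono {X : Type*} [TopologicalSpace X] {i : ℕ} {A A' B B' : Set X} {x0 : X}
    {h : Cube (i + 1) → X} (hh : IsRelMap i A B x0 h) (hA : A ⊆ A') (hB : B ⊆ B') :
    IsRelMap i A' B' x0 h :=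
  ⟨hh.continuous, fun p => hA (hh.mem_total p), fun p hp => hB (hh.mem_base p hp),
    hh.eq_base_pt⟩

theorem RelHomotopic.mono {X : Type*} [TopologicalSpace X] {i : ℕ} {A A' B B' : Set X}
    {x0 : X} {h₀ h₁ : Cube (i + 1) → X} (hr : RelHomotopic i A B x0 h₀ h₁)
    (hA : A ⊆ A') (hB : B ⊆ B') : RelHomotopic i A' B' x0 h₀ h₁ := by
  obtain ⟨H, hc, hsl, h0, h1⟩ := hr
  exact ⟨H, hc, fun τ => (hsl τ).mono hA hB, h0, h1⟩

/-- The map of relative homotopy groups induced by an inclusion of pairs `(A,B) ⊆ (A',B')`. -/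
def RelPi.incl {X : Type*} [TopologicalSpace X] {i : ℕ} {A A' B B' : Set X} {x0 : X}
    (hA : A ⊆ A') (hB : B ⊆ B') : RelPi i A B x0 → RelPi i A' B' x0 :=
  Quot.map (fun h => ⟨h.1, h.2.mono hA hB⟩) fun _ _ hr => hr.mono hA hB

/-! ### Serre fibrations, locally trivial fibrations, s-arcs -/

/-- A continuous surjection `p : E → B` is a Serre fibration if it has the homotopy lifting
property with respect to all finite-dimensional cubes. -/
def IsSerreFibration {E B : Type*} [TopologicalSpace E] [TopologicalSpace B]
    (p : E → B) : Prop :=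
  Continuous p ∧ Function.Surjective p ∧
    ∀ (k : ℕ) (H : Cube k × I → B) (h : Cube k → E),
      Continuous H → Continuous h → (∀ q, p (h q) = H (q, 0)) →
      ∃ G : Cube k × I → E, Continuous G ∧ (∀ q, p (G q) = H q) ∧ ∀ q, G (q, 0) = h q

/-- `f` is a locally trivial fibration over `S`: every `t ∈ S` has a neighborhood `V ∩ S`
in `S` such that `f ⁻¹' (V ∩ S)` is homeomorphic to `(V ∩ S) × f ⁻¹' {t}` over `f`. -/
def IsLocTrivOn {E B : Type*} [TopologicalSpace E] [TopologicalSpace B]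
    (f : E → B) (S : Set B) : Prop :=
  ∀ t ∈ S, ∃ V : Set B, IsOpen V ∧ t ∈ V ∧
    ∃ φ : ↥(f ⁻¹' (V ∩ S)) ≃ₜ ↥(V ∩ S) × ↥(f ⁻¹' {t}), ∀ x, ((φ x).1 : B) = f (x : E)

/-- `δ` is an s-arc on `S` at `t0`: the image of an embedding `γ : [0,1] → B` with
`γ 0 = t0` and `γ((0,1]) ⊆ S`. -/
def IsSArc {B : Type*} [TopologicalSpace B] (S : Set B) (t0 : B) (δ : Set B) : Prop :=
  ∃ γ : I → B, Continuous γ ∧ Function.Injective γ ∧ γ 0 = t0 ∧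
    (∀ s : I, s ≠ 0 → γ s ∈ S) ∧ δ = Set.range γ

/-- `f` has no vanishing component at `t0`: for every embedded arc `γ` starting at `t0`
over whose image minus `t0` the map `f` is a locally trivial fibration, every connected
component of `f ⁻¹' (γ((0,1]))` has closure meeting the fiber `f ⁻¹' {t0}`. -/
def NoVanishingComponent {E B : Type*} [TopologicalSpace E] [TopologicalSpace B]
    (f : E → B) (t0 : B) : Prop :=
  ∀ γ : I → B, Continuous γ → Function.Injective γ → γ 0 = t0 →
    IsLocTrivOn f (γ '' {s : I | s ≠ 0}) →
    ∀ x ∈ f ⁻¹' (γ '' {s : I | s ≠ 0}),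
      (closure (connectedComponentIn (f ⁻¹' (γ '' {s : I | s ≠ 0})) x) ∩
        f ⁻¹' {t0}).Nonempty

/-! ### Polynomial maps and semialgebraic sets -/

/-- A polynomial map `ℝ^m → ℝ^n`: each component is (the evaluation of) a real
polynomial in `m` variables. -/
def IsPolyMap {m n : ℕ} (f : EuclideanSpace ℝ (Fin m) → EuclideanSpace ℝ (Fin n)) : Prop :=
  ∀ j : Fin n, ∃ P : MvPolynomial (Fin m) ℝ, ∀ x, f x j = MvPolynomial.eval (fun k => x k) P

/-- Semialgebraic subsets of `ℝ^n`. -/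
inductive IsSemialgebraic {n : ℕ} : Set (EuclideanSpace ℝ (Fin n)) → Prop
  | zeroSet (P : MvPolynomial (Fin n) ℝ) :
      IsSemialgebraic {x | MvPolynomial.eval (fun j => x j) P = 0}
  | posSet (P : MvPolynomial (Fin n) ℝ) :
      IsSemialgebraic {x | 0 < MvPolynomial.eval (fun j => x j) P}
  | union {s t : Set (EuclideanSpace ℝ (Fin n))} :
      IsSemialgebraic s → IsSemialgebraic t → IsSemialgebraic (s ∪ t)
  | inter {s t : Set (EuclideanSpace ℝ (Fin n))} :
      IsSemialgebraic s → IsSemialgebraic t → IsSemialgebraic (s ∩ t)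
  | compl {s : Set (EuclideanSpace ℝ (Fin n))} :
      IsSemialgebraic s → IsSemialgebraic sᶜ

/-! ### Spheres, vanishing and emerging cycles -/

/-- The `i`-dimensional sphere, realized as the unit sphere in `ℝ^{i+1}`. -/
def SphS (i : ℕ) : Set (EuclideanSpace ℝ (Fin (i + 1))) := Metric.sphere 0 1

/-- The base point of the `i`-dimensional sphere. -/
def spherePt (i : ℕ) : ↥(SphS i) := ⟨EuclideanSpace.single 0 1, by simp [SphS]⟩

/-- A map `h : Z → E` is null-homotopic in `A ⊆ E` (its image being contained in `A`)
if it is homotopic within `A` to a constant map. -/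
def NullHomotopicIn {Z E : Type*} [TopologicalSpace Z] [TopologicalSpace E]
    (h : Z → E) (A : Set E) : Prop :=
  ∃ (H : Z × I → E) (c : E), Continuous H ∧ (∀ q, H q ∈ A) ∧
    (∀ z, H (z, 0) = h z) ∧ ∀ z, H (z, 1) = c

/-- Two maps `h₀ h₁ : Z → E` are (freely) homotopic in `A ⊆ E`. -/
def HomotopicIn {Z E : Type*} [TopologicalSpace Z] [TopologicalSpace E]
    (h₀ h₁ : Z → E) (A : Set E) : Prop :=
  ∃ H : Z × I → E, Continuous H ∧ (∀ q, H q ∈ A) ∧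
    (∀ z, H (z, 0) = h₀ z) ∧ ∀ z, H (z, 1) = h₁ z

/-- Two maps `h₀ h₁ : Z → E` are homotopic in `A ⊆ E` relative to the base point `z0`. -/
def HomotopicInRel {Z E : Type*} [TopologicalSpace Z] [TopologicalSpace E]
    (h₀ h₁ : Z → E) (A : Set E) (z0 : Z) : Prop :=
  ∃ H : Z × I → E, Continuous H ∧ (∀ q, H q ∈ A) ∧
    (∀ z, H (z, 0) = h₀ z) ∧ (∀ z, H (z, 1) = h₁ z) ∧ ∀ τ, H (z0, τ) = h₀ z0

/-- A vanishing `i`-cycle of `f` over the parametrized arc `γ`: a fibered map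
`g : S^i × [0,1] → E` over `γ` such that `g(·,s)` is null-homotopic in the fiber
`f ⁻¹' {γ s}` for every `s > 0`. -/
def IsVanishingCycle {E B : Type*} [TopologicalSpace E] [TopologicalSpace B]
    (f : E → B) (γ : I → B) (i : ℕ) (g : ↥(SphS i) × I → E) : Prop :=
  Continuous g ∧ (∀ x s, f (g (x, s)) = γ s) ∧
    ∀ s : I, s ≠ 0 → NullHomotopicIn (fun x => g (x, s)) (f ⁻¹' {γ s})

/-- A vanishing cycle is trivial if `g(·,0)` is also null-homotopic in `f ⁻¹' {γ 0}`. -/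
def VanishingCycleTrivial {E B : Type*} [TopologicalSpace E] [TopologicalSpace B]
    (f : E → B) (γ : I → B) (i : ℕ) (g : ↥(SphS i) × I → E) : Prop :=
  NullHomotopicIn (fun x => g (x, 0)) (f ⁻¹' {γ 0})

/-- An emerging `i`-cycle of `f` over the parametrized arc `γ`: a fibered map
`g : S^i × (0,1] → E` over `γ` such that the base point image `g(x₀,s)` has a limit
as `s → 0`. -/
def IsEmergingCycle {E B : Type*} [TopologicalSpace E] [TopologicalSpace B]
    (f : E → B) (γ : I → B) (i : ℕ) (g : ↥(SphS i) × {s : I // s ≠ 0} → E) : Prop :=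
  Continuous g ∧ (∀ x s, f (g (x, s)) = γ s.1) ∧
    ∃ L : E, Filter.Tendsto (fun s : {s : I // s ≠ 0} => g (spherePt i, s))
      (Filter.comap Subtype.val (𝓝[≠] (0 : I))) (𝓝 L)

/-- An emerging cycle is trivial if it agrees near `0`, up to fiberwise base-point
preserving homotopy, with a fibered map defined on `S^i × [0,ε)`. -/
def EmergingCycleTrivial {E B : Type*} [TopologicalSpace E] [TopologicalSpace B]
    (f : E → B) (γ : I → B) (i : ℕ) (g : ↥(SphS i) × {s : I // s ≠ 0} → E) : Prop :=
  ∃ ε : I, ε ≠ 0 ∧ ∃ g' : ↥(SphS i) × {s : I // (s : ℝ) < (ε : ℝ)} → E,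
    Continuous g' ∧ (∀ x s, f (g' (x, s)) = γ s.1) ∧
      ∀ (s : {s : I // s ≠ 0}) (hs : ((s : I) : ℝ) < (ε : ℝ)),
        g' (spherePt i, ⟨s.1, hs⟩) = g (spherePt i, s) ∧
        HomotopicInRel (fun x => g (x, s)) (fun x => g' (x, ⟨s.1, hs⟩))
          (f ⁻¹' {γ s.1}) (spherePt i)

/-! ### Deformations of pairs -/

/-- An inclusion of pairs `(A, B) ⊆ (A', B')` induces bijections on relative homotopy groups if
`(A', B')` can be deformed into `(A, B)` through self-maps of both pairs that fix the base
point. -/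
theorem RelPi.incl_bijective_of_deformation {X : Type*} [TopologicalSpace X] {i : ℕ}
    {A A' B B' : Set X} {x0 : X} (hA : A ⊆ A') (hB : B ⊆ B') (Φ : X × I → X)
    (hΦ : ContinuousOn Φ (A' ×ˢ univ)) (hzero : ∀ x ∈ A', Φ (x, 0) = x)
    (hmapA' : ∀ x ∈ A', ∀ τ, Φ (x, τ) ∈ A') (hmapB' : ∀ x ∈ B', ∀ τ, Φ (x, τ) ∈ B')
    (hmapA : ∀ x ∈ A, ∀ τ, Φ (x, τ) ∈ A) (hmapB : ∀ x ∈ B, ∀ τ, Φ (x, τ) ∈ B)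
    (honeA : ∀ x ∈ A', Φ (x, 1) ∈ A) (honeB : ∀ x ∈ B', Φ (x, 1) ∈ B)
    (hfix : ∀ τ, Φ (x0, τ) = x0) :
    Function.Bijective (RelPi.incl (i := i) (x0 := x0) hA hB) := by
  have comp_cont : ∀ {Z : Type} [TopologicalSpace Z] (g : Z → X) (t : Z → I), Continuous g →
      Continuous t → (∀ z, g z ∈ A') → Continuous fun z => Φ (g z, t z) :=
    fun g t hg ht hm => hΦ.comp_continuous (hg.prodMk ht) fun z => ⟨hm z, mem_univ _⟩
  have slice : ∀ {C D : Set X}, C ⊆ A' → (∀ x ∈ C, ∀ τ, Φ (x, τ) ∈ C) →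
      (∀ x ∈ D, ∀ τ, Φ (x, τ) ∈ D) → ∀ h, IsRelMap i C D x0 h → ∀ τ,
      IsRelMap i C D x0 fun p => Φ (h p, τ) := fun hC hmC hmD h hh τ =>
    ⟨comp_cont h _ hh.continuous continuous_const fun p => hC (hh.mem_total p),
      fun p => hmC _ (hh.mem_total p) τ, fun p hp => hmD _ (hh.mem_base p hp) τ,
      fun p hp => by rw [hh.eq_base_pt p hp, hfix]⟩
  have homotopic : ∀ {C D : Set X}, C ⊆ A' → (∀ x ∈ C, ∀ τ, Φ (x, τ) ∈ C) →
      (∀ x ∈ D, ∀ τ, Φ (x, τ) ∈ D) → ∀ h, IsRelMap i C D x0 h →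
      RelHomotopic i C D x0 h fun p => Φ (h p, 1) := fun hC hmC hmD h hh =>
    ⟨fun q => Φ (h q.1, q.2),
      comp_cont _ _ (hh.continuous.comp continuous_fst) continuous_snd
        fun q => hC (hh.mem_total q.1),
      slice hC hmC hmD h hh, fun p => hzero _ (hC (hh.mem_total p)), fun p => rfl⟩
  have retract : ∀ h, IsRelMap i A' B' x0 h → IsRelMap i A B x0 fun p => Φ (h p, 1) :=
    fun h hh => ⟨comp_cont h _ hh.continuous continuous_const hh.mem_total,
      fun p => honeA _ (hh.mem_total p), fun p hp => honeB _ (hh.mem_base p hp),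
      fun p hp => by rw [hh.eq_base_pt p hp, hfix]⟩
  let inv : RelPi i A' B' x0 → RelPi i A B x0 :=
    Quot.map (fun h => ⟨fun p => Φ (h.1 p, 1), retract h.1 h.2⟩) fun h₀ h₁ hr => by
      obtain ⟨H, hc, hsl, h0, h1⟩ := hr
      refine ⟨fun q => Φ (H q, 1), comp_cont H _ hc continuous_const
        fun q => (hsl q.2).mem_total q.1, fun τ => retract _ (hsl τ), fun p => ?_, fun p => ?_⟩
      · simp only [h0]
      · simp only [h1]
  refine Function.bijective_iff_has_inverse.2 ⟨inv, ?_, ?_⟩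
  · rintro ⟨h⟩
    refine (Quot.sound ?_).symm
    exact homotopic hA hmapA hmapB h.1 h.2
  · rintro ⟨h⟩
    refine (Quot.sound ?_).symm
    exact homotopic subset_rfl hmapA' hmapB' h.1 h.2

/-! ### Local sections of submersions -/

/-- Near a point where it is a submersion, a map has a continuous family of local sections
through all nearby points. -/
theorem HasStrictFDerivAt.exists_local_sections {E G : Type*} [NormedAddCommGroup E]
    [NormedSpace ℝ E] [CompleteSpace E] [NormedAddCommGroup G] [NormedSpace ℝ G]
    [FiniteDimensional ℝ G] {g : E → G} {g' : E →L[ℝ] G} {a : E}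
    (hg : HasStrictFDerivAt g g' a) (hsurj : Function.Surjective g') :
    ∃ (U : Set (E × G)) (sec : E × G → E), IsOpen U ∧ (a, g a) ∈ U ∧ ContinuousOn sec U ∧
      (∀ p ∈ U, g (sec p) = p.2) ∧ ∀ x, (x, g x) ∈ U → sec (x, g x) = x := by
  have hr : g'.range = ⊤ := LinearMap.range_eq_top.2 hsurj
  let e := hg.implicitToOpenPartialHomeomorph g g' hr
  have hfst : ∀ x, (e x).1 = g x := hg.implicitToOpenPartialHomeomorph_fst hr
  have hpair : ∀ x, (g x, (e x).2) = e x := fun x => Prod.ext (hfst x).symm rfl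
  have ha : a ∈ e.source := hg.mem_implicitToOpenPartialHomeomorph_source hr
  have hk : ContinuousOn (fun p : E × G => (p.2, (e p.1).2)) (e.source ×ˢ univ) :=
    continuousOn_snd.prodMk (continuous_snd.comp_continuousOn
      (e.continuousOn.comp continuousOn_fst fun p hp => hp.1))
  refine ⟨e.source ×ˢ univ ∩ (fun p : E × G => (p.2, (e p.1).2)) ⁻¹' e.target,
    fun p => e.symm (p.2, (e p.1).2), hk.isOpen_inter_preimage (e.open_source.prod isOpen_univ)
    e.open_target, ⟨⟨ha, mem_univ _⟩, ?_⟩, ?_, ?_, ?_⟩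
  · rw [mem_preimage, hpair]
    exact e.map_source ha
  · exact e.continuousOn_symm.comp (hk.mono inter_subset_left) fun p hp => hp.2
  · intro p hp
    rw [← hfst, e.right_inv hp.2]
  · intro x hx
    simp only [hpair]
    exact e.left_inv hx.1.1

/-- A submersion whose restriction to the sphere of radius `R` is a submersion too has
local sections that do not leave the closed ball of radius `R`. -/
theorem exists_local_sections_closedBall {E G : Type*} [NormedAddCommGroup E]
    [InnerProductSpace ℝ E] [CompleteSpace E] [NormedAddCommGroup G] [NormedSpace ℝ G]
    [FiniteDimensional ℝ G] {f : E → G} (hf : ContDiff ℝ 1 f) {R : ℝ} {a : E}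
    (ha : ‖a‖ ≤ R) (hsurj : Function.Surjective (fderiv ℝ f a))
    (hsphere : ‖a‖ = R → Function.Surjective (fderiv ℝ (fun y => (f y, ‖y‖ ^ 2)) a)) :
    ∃ (U : Set (E × G)) (sec : E × G → E), IsOpen U ∧ (a, f a) ∈ U ∧ ContinuousOn sec U ∧
      (∀ p ∈ U, f (sec p) = p.2) ∧ (∀ x, (x, f x) ∈ U → sec (x, f x) = x) ∧
      ∀ p ∈ U, p.1 ∈ closedBall (0 : E) R → sec p ∈ closedBall (0 : E) R := by
  rcases ha.lt_or_eq with hlt | heq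
  · obtain ⟨U, sec, hU, haU, hsec, hfsec, hid⟩ :=
      (hf.contDiffAt.hasStrictFDerivAt one_ne_zero).exists_local_sections hsurj
    refine ⟨U ∩ sec ⁻¹' ball 0 R, sec, hsec.isOpen_inter_preimage hU isOpen_ball, ⟨haU, ?_⟩,
      hsec.mono inter_subset_left, fun p hp => hfsec p hp.1, fun x hx => hid x hx.1,
      fun p hp _ => ball_subset_closedBall hp.2⟩
    simpa [hid a haU] using hlt
  · have hg : ContDiff ℝ 1 fun y : E => (f y, ‖y‖ ^ 2) := hf.prodMk (contDiff_norm_sq ℝ)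
    obtain ⟨U, sec, hU, haU, hsec, hfsec, hid⟩ :=
      (hg.contDiffAt.hasStrictFDerivAt one_ne_zero).exists_local_sections (hsphere heq)
    have hk : Continuous fun p : E × G => (p.1, (p.2, ‖p.1‖ ^ 2)) := by fun_prop
    refine ⟨(fun p : E × G => (p.1, (p.2, ‖p.1‖ ^ 2))) ⁻¹' U, fun p => sec (p.1, (p.2, ‖p.1‖ ^ 2)),
      hU.preimage hk, haU, hsec.comp hk.continuousOn fun p hp => hp,
      fun p hp => congrArg Prod.fst (hfsec _ hp), fun x hx => hid x hx, fun p hp hpR => ?_⟩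
    have hn : ‖sec (p.1, (p.2, ‖p.1‖ ^ 2))‖ ^ 2 = ‖p.1‖ ^ 2 := congrArg Prod.snd (hfsec _ hp)
    rw [mem_closedBall_zero_iff] at hpR ⊢
    rwa [(sq_eq_sq₀ (norm_nonneg _) (norm_nonneg _)).1 hn]

/-! ### Pushing compact parts of the initial fiber along an arc -/

/-- `Φ` is a homotopy of self-maps of `f ⁻¹' (γ([0,1]))`, starting at the identity, that
preserves `C`, fixes `x₀`, moves no point into the fiber over `γ 0`, and moves the
points of `S` in that fiber off it at once. -/
structure IsFiberPush {X Y : Type*} [TopologicalSpace X] (f : X → Y) (γ : I → Y)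
    (C : Set X) (x₀ : X) (S : Set X) (Φ : X × I → X) : Prop where
  continuousOn : ContinuousOn Φ ((f ⁻¹' range γ) ×ˢ univ)
  map_zero : ∀ x ∈ f ⁻¹' range γ, Φ (x, 0) = x
  mem_total : ∀ x ∈ f ⁻¹' range γ, ∀ τ, Φ (x, τ) ∈ f ⁻¹' range γ
  mem_of_mem : ∀ x ∈ f ⁻¹' range γ, x ∈ C → ∀ τ, Φ (x, τ) ∈ C
  fixed : ∀ τ, Φ (x₀, τ) = x₀
  eq_or_ne : ∀ x ∈ f ⁻¹' range γ, ∀ τ, Φ (x, τ) = x ∨ f (Φ (x, τ)) ≠ γ 0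
  ne_of_mem : ∀ x ∈ S, f x = γ 0 → ∀ τ, τ ≠ 0 → f (Φ (x, τ)) ≠ γ 0

namespace IsFiberPush

variable {X Y : Type*} [TopologicalSpace X] {f : X → Y} {γ : I → Y} {C : Set X} {x₀ : X}
  {S T : Set X} {Φ Ψ : X × I → X}

theorem ne_of_ne (hΦ : IsFiberPush f γ C x₀ S Φ) {x : X} (hx : x ∈ f ⁻¹' range γ)
    (hne : f x ≠ γ 0) (τ : I) : f (Φ (x, τ)) ≠ γ 0 := by
  rcases hΦ.eq_or_ne x hx τ with h | h
  · rwa [h]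
  · exact h

theorem fst_empty (f : X → Y) (γ : I → Y) (C : Set X) (x₀ : X) :
    IsFiberPush f γ C x₀ ∅ Prod.fst where
  continuousOn := continuousOn_fst
  map_zero _ _ := rfl
  mem_total _ hx _ := hx
  mem_of_mem _ _ hx _ := hx
  fixed _ := rfl
  eq_or_ne _ _ _ := Or.inl rfl
  ne_of_mem _ hx := hx.elim

theorem mono (hΦ : IsFiberPush f γ C x₀ T Φ) (h : S ⊆ T) : IsFiberPush f γ C x₀ S Φ :=
  { hΦ with ne_of_mem := fun x hx => hΦ.ne_of_mem x (h hx) }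

theorem comp (hΦ : IsFiberPush f γ C x₀ S Φ) (hΨ : IsFiberPush f γ C x₀ T Ψ) :
    IsFiberPush f γ C x₀ (S ∪ T) fun q => Ψ (Φ q, q.2) where
  continuousOn := hΨ.continuousOn.comp (hΦ.continuousOn.prodMk continuousOn_snd)
    fun q hq => ⟨hΦ.mem_total q.1 hq.1 q.2, mem_univ _⟩
  map_zero x hx := by simp only [hΦ.map_zero x hx, hΨ.map_zero x hx]
  mem_total x hx τ := hΨ.mem_total _ (hΦ.mem_total x hx τ) τ
  mem_of_mem x hx hC τ := hΨ.mem_of_mem _ (hΦ.mem_total x hx τ) (hΦ.mem_of_mem x hx hC τ) τ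
  fixed τ := by simp only [hΦ.fixed, hΨ.fixed]
  eq_or_ne x hx τ := by
    rcases hΦ.eq_or_ne x hx τ with h | h
    · simp only [h]
      exact hΨ.eq_or_ne x hx τ
    · exact Or.inr (hΨ.ne_of_ne (hΦ.mem_total x hx τ) h τ)
  ne_of_mem x hx h0 τ hτ := by
    have hxT : x ∈ f ⁻¹' range γ := ⟨0, h0.symm⟩
    rcases hx with hx | hx
    · exact hΨ.ne_of_ne (hΦ.mem_total x hxT τ) (hΦ.ne_of_mem x hx h0 τ hτ) τ
    · rcases hΦ.eq_or_ne x hxT τ with h | h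
      · simp only [h]
        exact hΨ.ne_of_mem x hx h0 τ hτ
      · exact hΨ.ne_of_ne (hΦ.mem_total x hxT τ) h τ

end IsFiberPush

/-- Local sections of `f` near `a` that preserve `C` give a push of a neighborhood of `a`. -/
theorem exists_isFiberPush_nhds {X Y : Type*} [MetricSpace X] [TopologicalSpace Y] [T2Space Y]
    {f : X → Y} (hf : Continuous f) {γ : I → Y} (hγc : Continuous γ)
    (hγi : Function.Injective γ) {C : Set X} {x₀ : X} (hx₀ : f x₀ ∈ γ '' {s : I | s ≠ 0})
    {a : X} {U : Set (X × Y)} {sec : X × Y → X} (hU : IsOpen U)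
    (haU : (a, γ 0) ∈ U) (hsec : ContinuousOn sec U) (hfsec : ∀ p ∈ U, f (sec p) = p.2)
    (hid : ∀ x, (x, f x) ∈ U → sec (x, f x) = x) (hC : ∀ p ∈ U, p.1 ∈ C → sec p ∈ C) :
    ∃ S ∈ 𝓝 a, ∃ Φ, IsFiberPush f γ C x₀ S Φ := by
  obtain ⟨s₀, hs₀, hfs₀⟩ := hx₀
  have hs₀pos : (0 : ℝ) < s₀ := lt_of_le_of_ne s₀.2.1 fun h => hs₀ (Subtype.ext h.symm)
  -- the arc, extended to all real parameters
  let c : ℝ → Y := fun r => γ (projIcc 0 1 zero_le_one r)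
  have hc : Continuous c := hγc.comp continuous_projIcc
  have hcs : ∀ s : I, c s = γ s := fun s => by simp only [c, projIcc_val]
  have hcne : ∀ r : ℝ, 0 < r → c r ≠ γ 0 := fun r hr h => by
    have h' := congrArg Subtype.val (hγi h)
    rw [coe_projIcc] at h'
    have : (0 : ℝ) < max 0 (min 1 r) := lt_max_of_lt_right (lt_min one_pos hr)
    simp only [Icc.coe_zero] at h'
    exact this.ne' h'
  -- the parameter of the image point
  let P : X → ℝ := fun x => (Function.invFun γ (f x) : I)
  have hPγ : ∀ (s : I) (x : X), f x = γ s → P x = s := fun s x h => by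
    simp only [P, h, Function.leftInverse_invFun hγi s]
  have hfP : ∀ x ∈ f ⁻¹' range γ, f x = c (P x) := by
    rintro x ⟨s, hs⟩
    rw [hPγ s x hs.symm, hcs, hs]
  have hP0 : ∀ x, 0 ≤ P x := fun x => (Function.invFun γ (f x)).2.1
  have hPc : ContinuousOn P (f ⁻¹' range γ) := by
    have h1 : ContinuousOn (Function.invFun γ) (range γ) := by
      rw [continuousOn_iff_continuous_domRestrict]
      have : (range γ).domRestrict (Function.invFun γ) ∘ rangeFactorization γ = id := by
        funext s
        exact Function.leftInverse_invFun hγi s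
      have hq : IsQuotientMap (rangeFactorization γ) :=
        (hγc.subtype_mk _).isClosedMap.isQuotientMap (hγc.subtype_mk _)
          rangeFactorization_surjective
      rw [hq.continuous_iff, this]
      exact continuous_id
    exact continuous_subtype_val.comp_continuousOn
      (h1.comp hf.continuousOn fun x hx => hx)
  -- a product neighborhood inside the domain of the local sections
  obtain ⟨W, hW, V, hV, hWV⟩ := mem_nhds_prod_iff.1 (hU.mem_nhds haU)
  obtain ⟨ρ, hρ, hρW⟩ := Metric.nhds_basis_closedBall.mem_iff.1 hW
  have hcV : c ⁻¹' V ∈ 𝓝 (0 : ℝ) := hc.continuousAt.preimage_mem_nhds (by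
    have : c 0 = γ 0 := by simpa using hcs 0
    rwa [this])
  obtain ⟨δ', hδ', hδV⟩ := Metric.nhds_basis_closedBall.mem_iff.1 hcV
  let δ : ℝ := min δ' s₀
  have hδ : 0 < δ := lt_min hδ' hs₀pos
  have hUmem : ∀ (x : X) (r : ℝ), dist x a ≤ ρ → 0 ≤ r → r ≤ δ → (x, c r) ∈ U :=
    fun x r hx h0 hr => hWV ⟨hρW hx, hδV (by
      rw [mem_closedBall, Real.dist_eq, sub_zero, abs_of_nonneg h0]
      exact hr.trans (min_le_left _ _))⟩
  let χ : X → ℝ := fun x => max 0 (min (ρ - dist x a) (δ - P x))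
  have hχ0 : ∀ x, 0 ≤ χ x := fun x => le_max_left _ _
  have hχc : ContinuousOn χ (f ⁻¹' range γ) := by
    refine continuousOn_const.sup (ContinuousOn.inf ?_ (continuousOn_const.sub hPc))
    exact (continuous_const.sub (continuous_id.dist continuous_const)).continuousOn
  have hχpos : ∀ x, 0 < χ x → dist x a ≤ ρ ∧ χ x ≤ δ - P x := by
    intro x hx
    have h1 : 0 < min (ρ - dist x a) (δ - P x) := by
      by_contra h
      exact hx.ne' (max_eq_left (not_lt.1 h))
    have h2 : χ x = min (ρ - dist x a) (δ - P x) := max_eq_right h1.le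
    exact ⟨by linarith [h1.trans_le (min_le_left _ _)], h2 ▸ min_le_right _ _⟩
  let r : X × I → ℝ := fun q => P q.1 + q.2 * χ q.1
  have hrc : ContinuousOn r ((f ⁻¹' range γ) ×ˢ univ) := by
    have h1 := hPc.comp (continuousOn_fst (s := (f ⁻¹' range γ) ×ˢ (univ : Set I)))
      fun q hq => hq.1
    have h2 := hχc.comp (continuousOn_fst (s := (f ⁻¹' range γ) ×ˢ (univ : Set I)))
      fun q hq => hq.1
    exact h1.add (ContinuousOn.mul
      (continuous_subtype_val.comp continuous_snd).continuousOn h2)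
  have hr0 : ∀ q, 0 ≤ r q := fun q => add_nonneg (hP0 _) (mul_nonneg q.2.2.1 (hχ0 _))
  have hrle : ∀ q : X × I, P q.1 ≤ δ → dist q.1 a ≤ ρ → (q.1, c (r q)) ∈ U := by
    rintro ⟨x, τ⟩ hPx hxa
    refine hUmem x _ hxa (hr0 _) ?_
    rcases (hχ0 x).eq_or_lt with h | h
    · simpa [r, ← h] using hPx
    · have := (hχpos x h).2
      have : (τ : ℝ) * χ x ≤ χ x := mul_le_of_le_one_left (hχ0 x) τ.2.2
      simp only [r]
      linarith
  have hrU : ∀ q : X × I, 0 < χ q.1 → (q.1, c (r q)) ∈ U := fun q h =>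
    hrle q (by linarith [(hχpos q.1 h).2]) (hχpos q.1 h).1
  classical
  let Φ : X × I → X := fun q => if χ q.1 = 0 then q.1 else sec (q.1, c (r q))
  have hΦ0 : ∀ q : X × I, χ q.1 = 0 → Φ q = q.1 := fun q h => if_pos h
  have hΦ1 : ∀ q : X × I, 0 < χ q.1 → Φ q = sec (q.1, c (r q)) := fun q h => if_neg h.ne'
  have hΦsec : ∀ q : X × I, q.1 ∈ f ⁻¹' range γ → (q.1, c (r q)) ∈ U →
      Φ q = sec (q.1, c (r q)) := by
    intro q hq hqU
    rcases (hχ0 q.1).eq_or_lt with h | h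
    · have hr : c (r q) = f q.1 := by
        rw [hfP q.1 hq]
        simp only [r, ← h, mul_zero, add_zero]
      rw [hr] at hqU ⊢
      rw [hid _ hqU, hΦ0 q h.symm]
    · exact hΦ1 q h
  have hfΦ : ∀ q : X × I, 0 < χ q.1 → f (Φ q) = c (r q) := fun q h => by
    rw [hΦ1 q h, hfsec _ (hrU q h)]
  have hzero : ∀ x ∈ f ⁻¹' range γ, Φ (x, 0) = x := by
    intro x hx
    rcases (hχ0 x).eq_or_lt with h | h
    · exact hΦ0 _ h.symm
    · have hr : c (r (x, 0)) = f x := by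
        rw [hfP x hx]
        simp [r]
      have hxU := hrU (x, 0) h
      rw [hΦ1 _ h]
      rw [hr] at hxU ⊢
      exact hid x hxU
  refine ⟨ball a ρ, ball_mem_nhds a hρ, Φ, ⟨?_, hzero, ?_, ?_, ?_, ?_, ?_⟩⟩
  · rintro ⟨x, τ⟩ hq
    have hpair : ContinuousWithinAt (fun q : X × I => (q.1, c (r q)))
        ((f ⁻¹' range γ) ×ˢ univ) (x, τ) :=
      continuousWithinAt_fst.prodMk (hc.continuousAt.comp_continuousWithinAt (hrc _ hq))
    by_cases hx : P x ≤ δ ∧ dist x a ≤ ρ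
    · have hqU := hrle (x, τ) hx.1 hx.2
      refine (ContinuousAt.comp_continuousWithinAt (f := fun q : X × I => (q.1, c (r q)))
        (hsec.continuousAt (hU.mem_nhds hqU)) hpair).congr_of_eventuallyEq_of_mem ?_ hq
      filter_upwards [hpair.preimage_mem_nhdsWithin (hU.mem_nhds hqU), self_mem_nhdsWithin]
        with q hqU' hqT
      exact hΦsec q hqT.1 hqU'
    · refine continuousWithinAt_fst.congr_of_eventuallyEq_of_mem ?_ hq
      have hcont : ContinuousWithinAt (fun q : X × I => min (ρ - dist q.1 a) (δ - P q.1))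
          ((f ⁻¹' range γ) ×ˢ univ) (x, τ) := by
        refine ContinuousWithinAt.inf ?_ (continuousWithinAt_const.sub
          (ContinuousWithinAt.comp (f := Prod.fst) (g := P) (hPc x hq.1) continuousWithinAt_fst
            fun q hq => hq.1))
        exact (continuous_const.sub (continuous_fst.dist continuous_const)).continuousWithinAt
      have hneg : min (ρ - dist x a) (δ - P x) < 0 := by
        rw [min_lt_iff, sub_neg, sub_neg]
        by_contra! h
        exact hx ⟨h.2, h.1⟩
      filter_upwards [hcont.eventually_lt_const hneg] with q hq'
      exact hΦ0 q (max_eq_left hq'.le)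
  · intro x hx τ
    rcases (hχ0 x).eq_or_lt with h | h
    · rwa [hΦ0 (x, τ) h.symm]
    · rw [mem_preimage, hfΦ (x, τ) h]
      exact mem_range_self _
  · intro x _ hxC τ
    rcases (hχ0 x).eq_or_lt with h | h
    · rwa [hΦ0 (x, τ) h.symm]
    · rw [hΦ1 (x, τ) h]
      exact hC _ (hrU (x, τ) h) hxC
  · intro τ
    refine hΦ0 (x₀, τ) (max_eq_left ((min_le_right _ _).trans ?_))
    rw [hPγ s₀ x₀ hfs₀.symm]
    exact sub_nonpos.2 (min_le_right _ _)
  · intro x hx τ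
    rcases (hχ0 x).eq_or_lt with h | h
    · exact Or.inl (hΦ0 (x, τ) h.symm)
    · rcases eq_or_ne τ 0 with rfl | hτ
      · exact Or.inl (hzero x hx)
      · refine Or.inr ?_
        rw [hfΦ (x, τ) h]
        exact hcne _ (add_pos_of_nonneg_of_pos (hP0 x)
          (mul_pos (unitInterval.pos_iff_ne_zero.2 hτ) h))
  · intro x hx h0 τ hτ
    have hPx : P x = 0 := by simpa using hPγ 0 x h0
    have h : 0 < χ x := lt_max_of_lt_right (lt_min (sub_pos.2 hx) (by rwa [hPx, sub_zero]))
    rw [hfΦ (x, τ) h]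
    exact hcne _ (add_pos_of_nonneg_of_pos (hP0 x)
      (mul_pos (unitInterval.pos_iff_ne_zero.2 hτ) h))

theorem IsPolyMap.contDiff {m n : ℕ}
    {f : EuclideanSpace ℝ (Fin m) → EuclideanSpace ℝ (Fin n)} (hf : IsPolyMap f)
    (k : WithTop ℕ∞) : ContDiff ℝ k f := by
  rw [contDiff_euclidean]
  intro j
  obtain ⟨Q, hQ⟩ := hf j
  simp only [hQ]
  clear hQ
  induction Q using MvPolynomial.induction_on with
  | C r => simpa using contDiff_const
  | add p q hp hq => simpa using hp.add hq
  | mul_X p l hp =>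
    simp only [map_mul, MvPolynomial.eval_X]
    exact hp.mul (contDiff_euclidean.1 contDiff_id l)

/-- **Lemma 3.6 (Lemma 28).** In the arc-and-ball setting, assuming moreover that `f` is a
submersion on `E_{[0,1]}`, the inclusion of pairs
`(E_{(0,1]}, E^R_{(0,1]}) ⊆ (E⁻_{[0,1]}, E^R_{[0,1]})` induces an isomorphism
`π_{i+1}(E_{(0,1]}, E^R_{(0,1]}, x*^R) ≅ π_{i+1}(E⁻_{[0,1]}, E^R_{[0,1]}, x*^R)` for every
`i` and every `x*^R ∈ E^R_{(0,1]}`. -/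
theorem relPi_incl_bijective_E01openExtreme
    (m n : ℕ) (hmn : n < m)
    (f : EuclideanSpace ℝ (Fin m) → EuclideanSpace ℝ (Fin n)) (hf : IsPolyMap f)
    (γ : I → EuclideanSpace ℝ (Fin n)) (hγc : Continuous γ)
    (hγi : Function.Injective γ)
    (t0 : EuclideanSpace ℝ (Fin n)) (hγ0 : γ 0 = t0)
    (hlt : IsLocTrivOn f (γ '' {s : I | s ≠ 0}))
    (R ε : ℝ) (hR : 0 < R) (hε : 0 < ε)
    (hcyl : ∀ r : ℝ, R ≤ r →
      Nonempty
        (↥(f ⁻¹' {t0} \ Metric.closedBall (0 : EuclideanSpace ℝ (Fin m)) r) ≃ₜ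
          ↥(f ⁻¹' {t0} ∩ Metric.sphere (0 : EuclideanSpace ℝ (Fin m)) r) × ℝ))
    (htrans : ∀ (s : I) (u : ℝ), u ∈ Set.Icc 0 ε → ∀ x, f x = γ s → ‖x‖ = R + u →
      Function.Surjective (fderiv ℝ (fun y => (f y, ‖y‖ ^ 2)) x))
    (hltB : IsLocTrivOn
      (fun x : ↥(f ⁻¹' (Set.range γ) ∩
          Metric.closedBall (0 : EuclideanSpace ℝ (Fin m)) (R + ε)) => f x.1)
      (Set.range γ))
    (hsubm : ∀ x, f x ∈ Set.range γ → Function.Surjective (fderiv ℝ f x))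
    (i : ℕ) (xsR : EuclideanSpace ℝ (Fin m))
    (hxsR : xsR ∈ f ⁻¹' (γ '' {s : I | s ≠ 0}) ∩
      Metric.closedBall (0 : EuclideanSpace ℝ (Fin m)) R) :
    ∀ (hA : f ⁻¹' (γ '' {s : I | s ≠ 0}) ⊆
        f ⁻¹' (Set.range γ) \
          (f ⁻¹' {t0} \ Metric.closedBall (0 : EuclideanSpace ℝ (Fin m)) R))
      (hB : f ⁻¹' (γ '' {s : I | s ≠ 0}) ∩
          Metric.closedBall (0 : EuclideanSpace ℝ (Fin m)) R ⊆
        f ⁻¹' (Set.range γ) ∩ Metric.closedBall (0 : EuclideanSpace ℝ (Fin m)) R),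
      Function.Bijective (RelPi.incl (i := i) (x0 := xsR) hA hB) := by
  intro hA hB
  subst hγ0
  have hfC : ContDiff ℝ 1 f := hf.contDiff 1
  have hK : IsCompact (f ⁻¹' {γ 0} ∩ closedBall (0 : EuclideanSpace ℝ (Fin m)) R) :=
    (isCompact_closedBall 0 R).inter_left (isClosed_singleton.preimage hfC.continuous)
  obtain ⟨Φ, hΦ⟩ : ∃ Φ, IsFiberPush f γ (closedBall 0 R) xsR
      (f ⁻¹' {γ 0} ∩ closedBall (0 : EuclideanSpace ℝ (Fin m)) R) Φ := by
    refine hK.induction_on (p := fun S => ∃ Φ, IsFiberPush f γ (closedBall 0 R) xsR S Φ)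
      ⟨_, IsFiberPush.fst_empty _ _ _ _⟩ (fun S T hST ⟨Φ, hΦ⟩ => ⟨Φ, hΦ.mono hST⟩)
      (fun S T ⟨Φ, hΦ⟩ ⟨Ψ, hΨ⟩ => ⟨_, hΦ.comp hΨ⟩) ?_
    rintro a ⟨ha0, haR⟩
    rw [mem_preimage, mem_singleton_iff] at ha0
    obtain ⟨U, sec, hU, haU, hsec, hfsec, hid, hC⟩ := exists_local_sections_closedBall hfC
      (mem_closedBall_zero_iff.1 haR) (hsubm a ⟨0, ha0.symm⟩)
      fun h => htrans 0 0 ⟨le_rfl, hε.le⟩ a ha0 (by rw [h, add_zero])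
    rw [ha0] at haU
    obtain ⟨S, hS, h⟩ := exists_isFiberPush_nhds hfC.continuous hγc hγi hxsR.1 hU haU hsec hfsec
      hid hC
    exact ⟨S, mem_nhdsWithin_of_mem_nhds hS, h⟩
  have hpos : ∀ x, f x ∈ γ '' {s : I | s ≠ 0} ↔ f x ∈ range γ ∧ f x ≠ γ 0 := by
    refine fun x => ⟨?_, ?_⟩
    · rintro ⟨s, hs, hsx⟩
      exact ⟨⟨s, hsx⟩, fun h => hs (hγi (hsx.trans h))⟩
    · rintro ⟨⟨s, hs⟩, hne⟩
      exact ⟨s, fun h => hne (by rw [← hs, h]), hs⟩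
  have hstay : ∀ x ∈ f ⁻¹' (γ '' {s : I | s ≠ 0}), ∀ τ,
      Φ (x, τ) ∈ f ⁻¹' (γ '' {s : I | s ≠ 0}) := fun x hx τ =>
    have hx' := (hpos x).1 hx
    (hpos _).2 ⟨hΦ.mem_total x hx'.1 τ, hΦ.ne_of_ne hx'.1 hx'.2 τ⟩
  have hone : ∀ x ∈ f ⁻¹' range γ \ (f ⁻¹' {γ 0} \ closedBall 0 R),
      Φ (x, 1) ∈ f ⁻¹' (γ '' {s : I | s ≠ 0}) := by
    rintro x ⟨hx, hxR⟩
    refine (hpos _).2 ⟨hΦ.mem_total x hx 1, ?_⟩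
    by_cases h0 : f x = γ 0
    · exact hΦ.ne_of_mem x ⟨h0, not_not.1 fun h => hxR ⟨h0, h⟩⟩ h0 1 one_ne_zero
    · exact hΦ.ne_of_ne hx h0 1
  refine RelPi.incl_bijective_of_deformation hA hB Φ
    (hΦ.continuousOn.mono (prod_mono sdiff_subset subset_rfl)) (fun x hx => hΦ.map_zero x hx.1)
    ?_ (fun x hx τ => ⟨hΦ.mem_total x hx.1 τ, hΦ.mem_of_mem x hx.1 hx.2 τ⟩) hstay
    (fun x hx τ => ⟨hstay x hx.1 τ, hΦ.mem_of_mem x (hA hx.1).1 hx.2 τ⟩) hone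
    (fun x hx => ⟨hone x ⟨hx.1, fun h => h.2 hx.2⟩, hΦ.mem_of_mem x hx.1 hx.2 1⟩) hΦ.fixed
  intro x hx τ
  refine ⟨hΦ.mem_total x hx.1 τ, fun h => ?_⟩
  rcases hΦ.eq_or_ne x hx.1 τ with h' | h'
  · rw [h'] at h
    exact hx.2 h
  · exact h' h.1
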